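/- arXiv:2503.07625 — 2 statements merged into one kernel-verified Lean document; each statement's English description precedes it below -/
import Mathlib

section
/- There exists a function c : ℝ → ℝ with c(x) = o(1) as x → ∞ such that for all real x, π(x) = (1 + c(x)) · x / log x. -/
open Filter Real

open MeasureTheory Set
open scoped Topology

/-- The Fejér kernel `sinc (v / 2) ^ 2` is the Fourier transform of the triangle function. -/
theorem integral_triangle_mul_cexp (v : ℝ) :
    ∫ τ in (-1 : ℝ)..1, ((1 - |τ| : ℝ) : ℂ) * Complex.exp (-(τ * v * Complex.I)) =
      ((sinc (v / 2) ^ 2 : ℝ) : ℂ) := by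
  have hcont : Continuous fun τ : ℝ ↦
      ((1 - |τ| : ℝ) : ℂ) * Complex.exp (-(τ * v * Complex.I)) := by fun_prop
  rcases eq_or_ne v 0 with rfl | hv
  · have h₁ : ∫ τ in (-1 : ℝ)..1, (1 - |τ|) = 1 := by
      rw [← intervalIntegral.integral_add_adjacent_intervals (b := 0)
        (Continuous.intervalIntegrable (by fun_prop) _ _)
        (Continuous.intervalIntegrable (by fun_prop) _ _),
        intervalIntegral.integral_congr (g := fun τ ↦ 1 + τ)
          (fun τ hτ ↦ by rw [uIcc_of_le (by norm_num)] at hτ; simp [abs_of_nonpos hτ.2]),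
        intervalIntegral.integral_congr (a := 0) (g := fun τ ↦ 1 - τ)
          (fun τ hτ ↦ by rw [uIcc_of_le (by norm_num)] at hτ; simp [abs_of_nonneg hτ.1])]
      rw [intervalIntegral.integral_add (by simp) (by simp),
        intervalIntegral.integral_sub (by simp) (by simp)]
      norm_num
    simp only [Complex.ofReal_zero, mul_zero, zero_mul, neg_zero, Complex.exp_zero, mul_one,
      intervalIntegral.integral_ofReal, h₁]
    simp
  · have hv' : (v : ℂ) ≠ 0 := by exact_mod_cast hv
    set a : ℂ := -(v * Complex.I) with ha
    have ha0 : a ≠ 0 := by simp [ha, hv]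
    have hexp (τ : ℝ) : HasDerivAt (fun τ : ℝ ↦ Complex.exp (a * τ)) (a * Complex.exp (a * τ)) τ := by
      have := ((Complex.ofRealCLM.hasDerivAt (x := τ)).const_mul a).cexp
      simpa [mul_comm] using this
    have hid (τ : ℝ) : HasDerivAt (fun τ : ℝ ↦ (τ : ℂ)) 1 τ := by
      simpa using (hasDerivAt_id τ).ofReal_comp
    have hpos : ∫ τ in (0 : ℝ)..1, (1 - τ : ℂ) * Complex.exp (a * τ) =
        Complex.exp a / a ^ 2 - 1 / a - 1 / a ^ 2 := by
      rw [intervalIntegral.integral_eq_sub_of_hasDerivAt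
        (f := fun τ : ℝ ↦ (1 - τ : ℂ) * (Complex.exp (a * τ) / a) + Complex.exp (a * τ) / a ^ 2)
        (fun τ _ ↦ ?_) (Continuous.intervalIntegrable (by fun_prop) _ _)]
      · simp; ring
      · convert! (((hid τ).const_sub 1).mul ((hexp τ).div_const a)).add
          ((hexp τ).div_const (a ^ 2)) using 1
        field_simp
        ring
    have hneg : ∫ τ in (-1 : ℝ)..0, (1 + τ : ℂ) * Complex.exp (a * τ) =
        1 / a - 1 / a ^ 2 + Complex.exp (-a) / a ^ 2 := by
      rw [intervalIntegral.integral_eq_sub_of_hasDerivAt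
        (f := fun τ : ℝ ↦ (1 + τ : ℂ) * (Complex.exp (a * τ) / a) - Complex.exp (a * τ) / a ^ 2)
        (fun τ _ ↦ ?_) (Continuous.intervalIntegrable (by fun_prop) _ _)]
      · simp
      · convert! (((hid τ).const_add 1).mul ((hexp τ).div_const a)).sub
          ((hexp τ).div_const (a ^ 2)) using 1
        field_simp
        ring
    rw [← intervalIntegral.integral_add_adjacent_intervals (b := 0)
        (hcont.intervalIntegrable _ _) (hcont.intervalIntegrable _ _),
      intervalIntegral.integral_congr (g := fun τ : ℝ ↦ (1 + τ : ℂ) * Complex.exp (a * τ))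
        (fun τ hτ ↦ by
          rw [uIcc_of_le (by norm_num)] at hτ
          simp only [abs_of_nonpos hτ.2, ha]; push_cast; ring_nf),
      intervalIntegral.integral_congr (a := 0)
        (g := fun τ : ℝ ↦ (1 - τ : ℂ) * Complex.exp (a * τ))
        (fun τ hτ ↦ by
          rw [uIcc_of_le (by norm_num)] at hτ
          simp only [abs_of_nonneg hτ.1, ha]; push_cast; ring_nf), hpos, hneg]
    have hcos : Complex.exp a + Complex.exp (-a) = 2 - 4 * Complex.sin (v / 2) ^ 2 := by
      have h := Complex.two_cos (v : ℂ)
      have h2 := Complex.cos_sq_add_sin_sq (v / 2 : ℂ)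
      have h3 := Complex.cos_two_mul (v / 2 : ℂ)
      rw [mul_div_cancel₀ _ two_ne_zero] at h3
      rw [ha, neg_neg, add_comm, ← neg_mul, ← h, h3]
      linear_combination 4 * h2
    have ha2 : a ^ 2 = - v ^ 2 := by rw [ha, neg_sq, mul_pow, Complex.I_sq]; ring
    rw [sinc_of_ne_zero (by positivity)]
    push_cast
    calc _ = (Complex.exp a + Complex.exp (-a) - 2) / a ^ 2 := by ring
      _ = _ := by rw [hcos, ha2]; field_simp; ring

theorem integrable_sinc_half_sq : Integrable fun v : ℝ ↦ sinc (v / 2) ^ 2 := by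
  refine (integrable_inv_one_add_sq.const_mul 5).mono'
    (by have := continuous_sinc; fun_prop) (.of_forall fun v ↦ ?_)
  rw [norm_of_nonneg (by positivity), ← div_eq_mul_inv, le_div_iff₀ (by positivity), mul_add]
  have h₁ : sinc (v / 2) ^ 2 ≤ 1 := (sq_le_one_iff_abs_le_one _).2 (abs_sinc_le_one _)
  have h₂ : sinc (v / 2) ^ 2 * v ^ 2 ≤ 4 := by
    rcases eq_or_ne v 0 with rfl | hv
    · simp
    · rw [sinc_of_ne_zero (by positivity)]
      calc _ = 4 * sin (v / 2) ^ 2 := by field_simp; ring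
        _ ≤ _ := by linarith [sin_sq_le_one (v / 2)]
  linarith

theorem integral_sinc_half_sq_pos : 0 < ∫ v : ℝ, sinc (v / 2) ^ 2 := by
  refine integral_pos_of_integrable_nonneg_nonzero (x := 0)
    (by have := continuous_sinc; fun_prop) integrable_sinc_half_sq (fun _ ↦ by positivity) ?_
  simp

/-- Smoothed Laplace transform identity, obtained by pairing with the Fejér kernel. -/
theorem integral_mul_cexp_mul_sinc_half_sq {g : ℝ → ℝ} (hg : Measurable g) {C : ℝ}
    (hC : ∀ u, |g u| ≤ C) {H : ℂ → ℂ}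
    (hH : ∀ s : ℂ, 0 < s.re → ∫ u in Ioi (0 : ℝ), (g u : ℂ) * Complex.exp (-(s * u)) = H s)
    {σ : ℝ} (hσ : 0 < σ) (x : ℝ) :
    ∫ u in Ioi (0 : ℝ), ((g u * rexp (-(σ * u)) * sinc ((u - x) / 2) ^ 2 : ℝ) : ℂ) =
      ∫ τ in (-1 : ℝ)..1, ((1 - |τ| : ℝ) : ℂ) * Complex.exp (τ * x * Complex.I) *
        H (σ + τ * Complex.I) := by
  have hexp : IntegrableOn (fun u ↦ rexp (-(σ * u))) (Ioi 0) := by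
    simpa using exp_neg_integrableOn_Ioi 0 hσ
  have hgexp : IntegrableOn (fun u ↦ (g u : ℂ) * (rexp (-(σ * u)) : ℂ)) (Ioi 0) := by
    refine (hexp.const_mul C).mono' (by fun_prop) (.of_forall fun u ↦ ?_)
    rw [norm_mul, Complex.norm_real, Complex.norm_real, norm_of_nonneg (exp_nonneg _)]
    exact mul_le_mul_of_nonneg_right (hC u) (exp_nonneg _)
  have hint : Integrable (Function.uncurry fun u τ : ℝ ↦ (g u : ℂ) * (rexp (-(σ * u)) : ℂ) *
      (((1 - |τ| : ℝ) : ℂ) * Complex.exp (-(τ * (u - x) * Complex.I))))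
      ((volume.restrict (Ioi (0 : ℝ))).prod (volume.restrict (Ioc (-1) 1))) := by
    have h1 : Integrable (fun _ : ℝ ↦ (1 : ℂ)) (volume.restrict (Ioc (-1 : ℝ) 1)) := by simp
    refine (hgexp.mul_prod h1).mono (by fun_prop) ?_
    rw [Measure.prod_restrict]
    refine (ae_restrict_iff' (measurableSet_Ioi.prod measurableSet_Ioc)).2 (.of_forall ?_)
    rintro ⟨u, τ⟩ ⟨-, hτ⟩
    have hτ' : |τ| ≤ 1 := abs_le.2 ⟨hτ.1.le, hτ.2⟩
    have he : ‖Complex.exp (-(τ * (u - x) * Complex.I))‖ = 1 := by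
      rw [show (-(τ * (u - x) * Complex.I) : ℂ) = ((-(τ * (u - x)) : ℝ) : ℂ) * Complex.I by
        push_cast; ring, Complex.norm_exp_ofReal_mul_I]
    simp only [Function.uncurry_apply_pair, norm_mul, he, mul_one, Complex.norm_real]
    refine mul_le_of_le_one_right (by positivity) ?_
    rw [norm_of_nonneg (by linarith)]
    linarith [abs_nonneg τ]
  calc
    _ = ∫ u in Ioi (0 : ℝ), ∫ τ in Ioc (-1 : ℝ) 1, (g u : ℂ) * (rexp (-(σ * u)) : ℂ) *
          (((1 - |τ| : ℝ) : ℂ) * Complex.exp (-(τ * (u - x) * Complex.I))) := by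
      congr 1 with u
      rw [integral_const_mul, ← intervalIntegral.integral_of_le (by norm_num)]
      have := integral_triangle_mul_cexp (u - x)
      push_cast at this ⊢
      rw [this]
    _ = ∫ τ in Ioc (-1 : ℝ) 1, ∫ u in Ioi (0 : ℝ), (g u : ℂ) * (rexp (-(σ * u)) : ℂ) *
          (((1 - |τ| : ℝ) : ℂ) * Complex.exp (-(τ * (u - x) * Complex.I))) :=
      integral_integral_swap hint
    _ = _ := by
      rw [intervalIntegral.integral_of_le (by norm_num)]
      congr 1 with τ
      rw [← hH _ (by simpa using hσ), ← integral_const_mul]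
      congr 1 with u
      have : Complex.exp (-(σ * u)) * Complex.exp (-(τ * (u - x) * Complex.I)) =
          Complex.exp (τ * x * Complex.I) * Complex.exp (-((σ + τ * Complex.I) * u)) := by
        rw [← Complex.exp_add, ← Complex.exp_add]
        ring_nf
      push_cast
      linear_combination (g u * (1 - |τ|) : ℂ) * this

theorem integral_mul_sinc_half_sq {g : ℝ → ℝ} (hg : Measurable g) {C : ℝ}
    (hC : ∀ u, |g u| ≤ C) {H : ℂ → ℂ} (hHc : ContinuousOn H {s | 0 ≤ s.re})
    (hH : ∀ s : ℂ, 0 < s.re → ∫ u in Ioi (0 : ℝ), (g u : ℂ) * Complex.exp (-(s * u)) = H s)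
    (x : ℝ) :
    ∫ u in Ioi (0 : ℝ), ((g u * sinc ((u - x) / 2) ^ 2 : ℝ) : ℂ) =
      ∫ τ in (-1 : ℝ)..1, ((1 - |τ| : ℝ) : ℂ) * Complex.exp (τ * x * Complex.I) *
        H (τ * Complex.I) := by
  have hK : Integrable fun u : ℝ ↦ sinc ((u - x) / 2) ^ 2 :=
    integrable_sinc_half_sq.comp_sub_right x
  have hKc : Continuous fun u : ℝ ↦ sinc ((u - x) / 2) ^ 2 := by
    have := continuous_sinc; fun_prop
  have hL : Tendsto (fun σ : ℝ ↦ ∫ u in Ioi (0 : ℝ),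
      ((g u * rexp (-(σ * u)) * sinc ((u - x) / 2) ^ 2 : ℝ) : ℂ)) (𝓝[>] 0)
      (𝓝 (∫ u in Ioi (0 : ℝ), ((g u * sinc ((u - x) / 2) ^ 2 : ℝ) : ℂ))) := by
    refine tendsto_integral_filter_of_dominated_convergence
      (fun u ↦ C * sinc ((u - x) / 2) ^ 2) (.of_forall fun σ ↦ ?_) ?_
      (hK.const_mul C).integrableOn ?_
    · exact (Complex.measurable_ofReal.comp
        ((hg.mul (by fun_prop)).mul hKc.measurable)).aestronglyMeasurable
    · filter_upwards [self_mem_nhdsWithin] with σ (hσ : 0 < σ)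
      refine (ae_restrict_iff' measurableSet_Ioi).2 (.of_forall fun u (hu : 0 < u) ↦ ?_)
      rw [Complex.norm_real, norm_mul, norm_mul, norm_of_nonneg (exp_nonneg _),
        norm_of_nonneg (sq_nonneg (sinc _))]
      refine mul_le_mul_of_nonneg_right ?_ (by positivity)
      refine (mul_le_of_le_one_right (norm_nonneg _) ?_).trans (hC u)
      rw [exp_le_one_iff]
      nlinarith [mul_pos hσ hu]
    · refine .of_forall fun u ↦ ?_
      have : Continuous fun σ : ℝ ↦ ((g u * rexp (-(σ * u)) * sinc ((u - x) / 2) ^ 2 : ℝ) : ℂ) := by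
        fun_prop
      simpa using (this.tendsto 0).mono_left nhdsWithin_le_nhds
  have hR : Tendsto (fun σ : ℝ ↦ ∫ τ in (-1 : ℝ)..1, ((1 - |τ| : ℝ) : ℂ) *
      Complex.exp (τ * x * Complex.I) * H (σ + τ * Complex.I)) (𝓝[>] 0)
      (𝓝 (∫ τ in (-1 : ℝ)..1, ((1 - |τ| : ℝ) : ℂ) * Complex.exp (τ * x * Complex.I) *
        H (τ * Complex.I))) := by
    have hcpt : IsCompact (Icc (0 : ℝ) 1 ×ℂ Icc (-1 : ℝ) 1) := isCompact_Icc.reProdIm isCompact_Icc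
    obtain ⟨M, hM⟩ := hcpt.exists_bound_of_continuousOn (hHc.mono fun s hs ↦ hs.1.1)
    have hline (σ : ℝ) (hσ : 0 ≤ σ) : Continuous fun τ : ℝ ↦ H (σ + τ * Complex.I) :=
      hHc.comp_continuous (by fun_prop) (by simpa using hσ)
    refine intervalIntegral.tendsto_integral_filter_of_dominated_convergence (fun _ ↦ M) ?_ ?_
      (by simp) ?_
    · filter_upwards [self_mem_nhdsWithin] with σ (hσ : 0 < σ)
      exact (Continuous.mul (by fun_prop) (hline σ hσ.le)).aestronglyMeasurable
    · filter_upwards [Ioc_mem_nhdsGT one_pos] with σ hσ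
      refine .of_forall fun τ hτ ↦ ?_
      rw [uIoc_of_le (by norm_num)] at hτ
      have hτ' : |τ| ≤ 1 := abs_le.2 ⟨hτ.1.le, hτ.2⟩
      have hb := hM (σ + τ * Complex.I) (by simp [Complex.mem_reProdIm, hσ.1.le, hσ.2, hτ.1.le, hτ.2])
      have he : ‖Complex.exp (τ * x * Complex.I)‖ = 1 := by
        rw [← Complex.ofReal_mul, Complex.norm_exp_ofReal_mul_I]
      rw [norm_mul, norm_mul, he, mul_one, Complex.norm_real, norm_of_nonneg (by linarith)]
      exact (mul_le_of_le_one_left (norm_nonneg _) (by linarith [abs_nonneg τ])).trans hb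
    · refine .of_forall fun τ _ ↦ Tendsto.const_mul _ ?_
      have hc : ContinuousWithinAt H {s | 0 ≤ s.re} (τ * Complex.I) := hHc _ (by simp)
      refine hc.tendsto.comp (tendsto_nhdsWithin_iff.2 ⟨?_, ?_⟩)
      · have : Continuous fun σ : ℝ ↦ (σ + τ * Complex.I : ℂ) := by fun_prop
        simpa using (this.tendsto 0).mono_left nhdsWithin_le_nhds
      · filter_upwards [self_mem_nhdsWithin] with σ (hσ : 0 < σ)
        simpa using hσ.le
  refine tendsto_nhds_unique hL (hR.congr' ?_)
  filter_upwards [self_mem_nhdsWithin] with σ (hσ : 0 < σ)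
  exact (integral_mul_cexp_mul_sinc_half_sq hg hC hH hσ x).symm

theorem tendsto_integral_mul_sinc_half_sq {g : ℝ → ℝ} (hg : Measurable g) {C : ℝ}
    (hC : ∀ u, |g u| ≤ C) {H : ℂ → ℂ} (hHc : ContinuousOn H {s | 0 ≤ s.re})
    (hH : ∀ s : ℂ, 0 < s.re → ∫ u in Ioi (0 : ℝ), (g u : ℂ) * Complex.exp (-(s * u)) = H s) :
    Tendsto (fun x ↦ ∫ u in Ioi (0 : ℝ), g u * sinc ((u - x) / 2) ^ 2) atTop (𝓝 0) := by
  have hRL := Real.tendsto_integral_exp_smul_cocompact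
    ((Ioc (-1 : ℝ) 1).indicator fun τ ↦ ((1 - |τ| : ℝ) : ℂ) * H (τ * Complex.I))
  have hlim : Tendsto (fun x : ℝ ↦ -(x / (2 * π))) atTop (cocompact ℝ) :=
    (tendsto_neg_atTop_atBot.comp (tendsto_id.atTop_div_const (by positivity))).mono_right
      atBot_le_cocompact
  have h := hRL.comp hlim
  rw [← Complex.ofReal_zero] at h
  refine (Complex.isometry_ofReal.isEmbedding.tendsto_nhds_iff).2 (h.congr fun x ↦ ?_)
  rw [Function.comp, Function.comp, ← integral_complex_ofReal, integral_mul_sinc_half_sq hg hC hHc hH,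
    intervalIntegral.integral_of_le (by norm_num), ← integral_indicator measurableSet_Ioc]
  congr 1 with τ
  by_cases hτ : τ ∈ Ioc (-1 : ℝ) 1
  · rw [indicator_of_mem hτ, indicator_of_mem hτ, Circle.smul_def, Real.fourierChar_apply, smul_eq_mul]
    have : ((2 * π * -(τ * -(x / (2 * π))) : ℝ) : ℂ) = τ * x := by
      push_cast; field_simp
    rw [this]
    ring
  · simp [hτ]

/-- A bounded function whose Laplace transform extends continuously to the imaginary axis cannot
stay above `ε` on long intervals far out, where the length depends only on `ε` and the bound. -/
theorem exists_forall_eventually_exists_lt (C : ℝ) {ε : ℝ} (hε : 0 < ε) :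
    ∃ B > 0, ∀ {g : ℝ → ℝ} {H : ℂ → ℂ}, Measurable g → (∀ u, |g u| ≤ C) →
      ContinuousOn H {s | 0 ≤ s.re} →
      (∀ s : ℂ, 0 < s.re → ∫ u in Ioi (0 : ℝ), (g u : ℂ) * Complex.exp (-(s * u)) = H s) →
      ∀ᶠ x in atTop, ∃ u ∈ Icc (x - B) (x + B), g u < ε := by
  rcases lt_or_ge C 0 with hC0 | hC0
  · exact ⟨1, one_pos, fun {g _} _ hC ↦ absurd ((abs_nonneg _).trans (hC 0)) (not_le.2 hC0)⟩
  set A := ∫ v : ℝ, sinc (v / 2) ^ 2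
  have hA : 0 < A := integral_sinc_half_sq_pos
  have hlim : Tendsto (fun B : ℝ ↦ ∫ v in -B..B, sinc (v / 2) ^ 2) atTop (𝓝 A) :=
    intervalIntegral_tendsto_integral integrable_sinc_half_sq tendsto_neg_atTop_atBot tendsto_id
  have hη : A - ε * A / (2 * (C + ε)) < A := sub_lt_self _ (by positivity)
  obtain ⟨B, hBA, hB⟩ := ((hlim.eventually_const_lt hη).and (eventually_gt_atTop 0)).exists
  refine ⟨B, hB, fun {g H} hg hC hHc hH ↦ ?_⟩
  have hmain : ε * A / 2 < (C + ε) * (∫ v in -B..B, sinc (v / 2) ^ 2) - C * A := by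
    have := mul_lt_mul_of_pos_left hBA (by positivity : 0 < C + ε)
    have h2 : (C + ε) * (A - ε * A / (2 * (C + ε))) = (C + ε) * A - ε * A / 2 := by field_simp
    linarith
  have hsmall := (tendsto_integral_mul_sinc_half_sq hg hC hHc hH).eventually_lt_const
    (by positivity : 0 < ε * A / 2)
  filter_upwards [hsmall, eventually_gt_atTop B] with x hx hxB
  by_contra! hcon
  have hK : Integrable fun u : ℝ ↦ sinc ((u - x) / 2) ^ 2 :=
    integrable_sinc_half_sq.comp_sub_right x
  have hgK : Integrable fun u : ℝ ↦ g u * sinc ((u - x) / 2) ^ 2 :=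
    hK.bdd_mul hg.aestronglyMeasurable (.of_forall hC)
  have hKB := (hK.const_mul (C + ε)).indicator (measurableSet_Ioc (a := x - B) (b := x + B))
  have hle : ∫ u in Ioi (0 : ℝ), ((Ioc (x - B) (x + B)).indicator
      (fun u ↦ (C + ε) * sinc ((u - x) / 2) ^ 2) u - C * sinc ((u - x) / 2) ^ 2) ≤
      ∫ u in Ioi (0 : ℝ), g u * sinc ((u - x) / 2) ^ 2 := by
    refine integral_mono (hKB.sub (hK.const_mul C)).integrableOn hgK.integrableOn fun u ↦ ?_
    have hK0 := sq_nonneg (sinc ((u - x) / 2))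
    by_cases hu : u ∈ Ioc (x - B) (x + B)
    · have := hcon u ⟨hu.1.le, hu.2⟩
      simp only [indicator_of_mem hu]
      nlinarith
    · have := (abs_le.1 (hC u)).1
      simp only [indicator_of_notMem hu]
      nlinarith
  rw [integral_sub hKB.integrableOn (hK.const_mul C).integrableOn,
    setIntegral_indicator measurableSet_Ioc,
    inter_eq_right.2 fun u hu ↦ mem_Ioi.2 ((sub_pos.2 hxB).trans hu.1),
    integral_const_mul, integral_const_mul, ← intervalIntegral.integral_of_le (by linarith),
    intervalIntegral.integral_comp_sub_right (fun v ↦ sinc (v / 2) ^ 2)] at hle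
  have htail : ∫ u in Ioi (0 : ℝ), sinc ((u - x) / 2) ^ 2 ≤ A :=
    (setIntegral_le_integral hK (.of_forall fun _ ↦ sq_nonneg _)).trans_eq
      (integral_sub_right_eq_self (fun v ↦ sinc (v / 2) ^ 2) x)
  have := mul_le_mul_of_nonneg_left htail hC0
  rw [sub_sub_cancel_left, add_sub_cancel_left] at hle
  linarith

theorem eventually_exists_lt {g : ℝ → ℝ} (hg : Measurable g) {C : ℝ}
    (hC : ∀ u, |g u| ≤ C) {H : ℂ → ℂ} (hHc : ContinuousOn H {s | 0 ≤ s.re})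
    (hH : ∀ s : ℂ, 0 < s.re → ∫ u in Ioi (0 : ℝ), (g u : ℂ) * Complex.exp (-(s * u)) = H s)
    {ε δ : ℝ} (hε : 0 < ε) (hδ : 0 < δ) :
    ∀ᶠ x in atTop, ∃ u ∈ Icc (x - δ) (x + δ), g u < ε := by
  obtain ⟨B, hB, h⟩ := exists_forall_eventually_exists_lt C hε
  set l := B / δ with hl_def
  have hl : 0 < l := by positivity
  have hscale := h (g := fun u ↦ g (l⁻¹ * u)) (H := fun s ↦ l * H (l * s)) (by fun_prop)
    (fun u ↦ hC _)
    (continuousOn_const.mul (hHc.comp (by fun_prop) fun s (hs : 0 ≤ s.re) ↦ by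
      simpa using mul_nonneg hl.le hs)) ?_
  · have hcomp := (tendsto_id.const_mul_atTop hl).eventually hscale
    filter_upwards [hcomp] with x ⟨u, hu, hgu⟩
    refine ⟨l⁻¹ * u, ?_, hgu⟩
    have hlδ : l * δ = B := by rw [hl_def]; field_simp
    rw [← hlδ, id, ← mul_sub, ← mul_add] at hu
    rw [mem_Icc, le_inv_mul_iff₀ hl, inv_mul_le_iff₀ hl]
    exact hu
  · intro s hs
    have hre : 0 < ((l : ℂ) * s).re := by simpa using mul_pos hl hs
    rw [← hH _ hre]
    have := integral_comp_mul_left_Ioi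
      (fun w ↦ (g w : ℂ) * Complex.exp (-(l * s * w))) 0 (inv_pos.2 hl)
    rw [mul_zero, inv_inv, Complex.real_smul] at this
    rw [← this]
    congr 1 with u
    have : (l : ℂ) ≠ 0 := by exact_mod_cast hl.ne'
    push_cast
    field_simp

open ArithmeticFunction.vonMangoldt Chebyshev

theorem LSeries_vonMangoldt_eq_mul_integral_psi {s : ℂ} (hs : 1 < s.re) :
    LSeries (fun n ↦ (Λ n : ℂ)) s = s * ∫ u in Ioi (0 : ℝ), (psi (rexp u) : ℂ) *
      Complex.exp (-(s * u)) := by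
  have hsum (n : ℕ) : ∑ k ∈ Finset.Icc 1 n, Λ k = psi n := by
    rw [psi, Nat.floor_natCast]; rfl
  rw [LSeries_eq_mul_integral_of_nonneg (fun n ↦ Λ n) zero_le_one hs ?_
    (fun n ↦ ArithmeticFunction.vonMangoldt_nonneg)]
  · congr 1
    have himg : rexp '' Ioi 0 = Ioi 1 := by rw [image_exp_Ioi, exp_zero]
    rw [← himg, integral_image_eq_integral_abs_deriv_smul measurableSet_Ioi
      (fun x _ ↦ (hasDerivAt_exp x).hasDerivWithinAt) exp_injective.injOn]
    congr 1 with u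
    have hpsi : ∑ k ∈ Finset.Icc 1 ⌊rexp u⌋₊, (Λ k : ℂ) = psi (rexp u) := by
      rw [psi_eq_psi_coe_floor, ← hsum]; push_cast; rfl
    rw [hpsi, abs_of_pos (exp_pos u), Complex.real_smul, Complex.ofReal_exp,
      Complex.cpow_def_of_ne_zero (Complex.exp_ne_zero _), ← Complex.ofReal_exp,
      ← Complex.ofReal_log (exp_pos u).le, log_exp, Complex.ofReal_exp, mul_left_comm,
      ← Complex.exp_add]
    ring_nf
  · refine Asymptotics.IsBigO.of_bound (log 4 + 4) (.of_forall fun n ↦ ?_)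
    rw [hsum, rpow_one, norm_of_nonneg (psi_nonneg _), norm_of_nonneg n.cast_nonneg]
    exact psi_le_const_mul_self n.cast_nonneg

theorem psi_exp_mul_exp_neg_le (u : ℝ) : psi (rexp u) * rexp (-u) ≤ log 4 + 4 := by
  rw [exp_neg, ← div_eq_mul_inv, div_le_iff₀ (exp_pos u)]
  exact psi_le_const_mul_self (exp_pos u).le

theorem measurable_psi_exp_mul_exp_neg : Measurable fun u ↦ psi (rexp u) * rexp (-u) :=
  (psi_mono.measurable.comp measurable_exp).mul (by fun_prop)

/-- The Laplace transform of `ψ(eᵘ)e⁻ᵘ - 1` extends continuously to the imaginary axis. -/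
theorem exists_continuousOn_laplace_psi : ∃ H : ℂ → ℂ, ContinuousOn H {s | 0 ≤ s.re} ∧
    ∀ s : ℂ, 0 < s.re → ∫ u in Ioi (0 : ℝ), ((psi (rexp u) * rexp (-u) - 1 : ℝ) : ℂ) *
      Complex.exp (-(s * u)) = H s := by
  have hne (s : ℂ) (hs : 0 ≤ s.re) : s + 1 ≠ 0 := fun h ↦ by
    have := congrArg Complex.re h
    simp at this
    linarith
  refine ⟨fun s ↦ (LFunctionResidueClassAux (1 : ZMod 1) (s + 1) - 1) / (s + 1), ?_, fun s hs ↦ ?_⟩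
  · refine ContinuousOn.div (ContinuousOn.sub ?_ continuousOn_const) (by fun_prop)
      fun s hs ↦ hne s hs
    exact (continuousOn_LFunctionResidueClassAux (1 : ZMod 1)).comp
      (f := fun s : ℂ ↦ s + 1) (by fun_prop) fun s (hs : 0 ≤ s.re) ↦ by simpa using hs
  · have hs1 : 1 < (s + 1).re := by simpa using hs
    have hL : LSeries (fun n ↦ (residueClass (1 : ZMod 1) n : ℂ)) (s + 1) =
        LSeries (fun n ↦ (Λ n : ℂ)) (s + 1) := by
      congr 1 with n
      rw [residueClass, indicator_of_mem (show n ∈ {m : ℕ | (m : ZMod 1) = 1}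
        from Subsingleton.elim _ _)]
    have hexp (a : ℂ) (ha : 0 < a.re) :
        IntegrableOn (fun u : ℝ ↦ Complex.exp (-(a * u))) (Ioi 0) := by
      simpa using integrableOn_exp_mul_complex_Ioi (a := -a) (by simpa using ha) 0
    have hint : IntegrableOn (fun u : ℝ ↦ ((psi (rexp u) * rexp (-u) : ℝ) : ℂ) *
        Complex.exp (-(s * u))) (Ioi 0) :=
      (hexp s hs).bdd_mul (c := log 4 + 4)
        (Complex.measurable_ofReal.comp measurable_psi_exp_mul_exp_neg).aestronglyMeasurable
        (.of_forall fun u ↦ by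
          rw [Complex.norm_real, norm_of_nonneg (mul_nonneg (psi_nonneg _) (exp_nonneg _))]
          exact psi_exp_mul_exp_neg_le u)
    have hs0 : s ≠ 0 := fun h ↦ by simp [h] at hs
    have hs1' := hne s hs.le
    have hone : ∫ u in Ioi (0 : ℝ), Complex.exp (-(s * u)) = 1 / s := by
      have := integral_exp_mul_complex_Ioi (a := -s) (by simpa using hs) 0
      simpa [neg_div_neg_eq] using this
    have hG := eqOn_LFunctionResidueClassAux (a := (1 : ZMod 1)) isUnit_one hs1
    simp only [hL, Nat.totient_one, LSeries_vonMangoldt_eq_mul_integral_psi hs1] at hG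
    simp only [Complex.ofReal_sub, sub_mul, Complex.ofReal_one, one_mul]
    rw [integral_sub hint (hexp s hs), hone, hG]
    have : ∫ u in Ioi (0 : ℝ), ((psi (rexp u) * rexp (-u) : ℝ) : ℂ) * Complex.exp (-(s * u)) =
        ∫ u in Ioi (0 : ℝ), (psi (rexp u) : ℂ) * Complex.exp (-((s + 1) * u)) := by
      congr 1 with u
      push_cast
      rw [mul_assoc, ← Complex.exp_add]
      ring_nf
    rw [this, add_sub_cancel_right]
    field_simp
    ring

theorem psi_exp_mul_exp_neg_mul_le {u v : ℝ} (h : u ≤ v) :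
    psi (rexp u) * rexp (-u) ≤ psi (rexp v) * rexp (-v) * rexp (v - u) := by
  rw [mul_assoc, ← exp_add, neg_add_eq_sub, sub_sub_cancel_left]
  exact mul_le_mul_of_nonneg_right (psi_mono (exp_le_exp.2 h)) (exp_nonneg _)

theorem tendsto_psi_exp_mul_exp_neg :
    Tendsto (fun u ↦ psi (rexp u) * rexp (-u)) atTop (𝓝 1) := by
  obtain ⟨H, hHc, hH⟩ := exists_continuousOn_laplace_psi
  have hm : Measurable fun u ↦ psi (rexp u) * rexp (-u) - 1 :=
    measurable_psi_exp_mul_exp_neg.sub_const 1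
  have hb (u : ℝ) : |psi (rexp u) * rexp (-u) - 1| ≤ log 4 + 4 := by
    have := psi_exp_mul_exp_neg_le u
    have h0 : 0 ≤ psi (rexp u) * rexp (-u) := mul_nonneg (psi_nonneg _) (exp_nonneg _)
    have h4 : 0 ≤ log 4 := log_nonneg (by norm_num)
    rw [abs_le]
    constructor <;> linarith
  have hupper {ε δ : ℝ} (hε : 0 < ε) (hδ : 0 < δ) := eventually_exists_lt hm hb hHc hH hε hδ
  have hlower {ε δ : ℝ} (hε : 0 < ε) (hδ : 0 < δ) :=
    eventually_exists_lt (g := fun u ↦ -(psi (rexp u) * rexp (-u) - 1)) (H := fun s ↦ -H s)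
      hm.neg (by simpa only [abs_neg] using hb) hHc.neg
      (fun s hs ↦ by
        rw [← hH s hs, ← integral_neg]
        congr 1 with u
        push_cast
        ring) hε hδ
  have hshift (δ : ℝ) : Tendsto (fun y : ℝ ↦ y + δ) atTop atTop :=
    tendsto_atTop_add_const_right _ _ tendsto_id
  rw [Metric.tendsto_nhds]
  intro η hη
  obtain ⟨ε, hε, hεη, hε1⟩ : ∃ ε > 0, 3 * ε ≤ η ∧ 3 * ε ≤ 1 :=
    ⟨min η 1 / 3, by positivity, by linarith [min_le_left η 1], by linarith [min_le_right η 1]⟩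
  set δ := log (1 + ε) / 2 with hδ_def
  have hδ : 0 < δ := half_pos (log_pos (by linarith))
  have hexpδ : rexp (2 * δ) = 1 + ε := by
    rw [hδ_def, mul_div_cancel₀ _ two_ne_zero, exp_log (by linarith)]
  filter_upwards [(hshift δ).eventually (hupper hε hδ), (hshift (-δ)).eventually (hlower hε hδ)]
    with y ⟨u, hu, hgu⟩ ⟨w, hw, hgw⟩
  have h₁ := psi_exp_mul_exp_neg_mul_le (u := y) (v := u) (by linarith [hu.1])
  have h₂ := psi_exp_mul_exp_neg_mul_le (u := w) (v := y) (by linarith [hw.2])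
  have h₃ : rexp (u - y) ≤ 1 + ε := hexpδ ▸ exp_le_exp.2 (by linarith [hu.2])
  have h₄ : rexp (y - w) ≤ 1 + ε := hexpδ ▸ exp_le_exp.2 (by linarith [hw.1])
  have hy : 0 ≤ psi (rexp y) * rexp (-y) := mul_nonneg (psi_nonneg _) (exp_nonneg _)
  have hu0 : 0 ≤ psi (rexp u) * rexp (-u) := mul_nonneg (psi_nonneg _) (exp_nonneg _)
  have h₅ := mul_le_mul_of_nonneg_left h₃ hu0
  have h₆ := mul_le_mul_of_nonneg_left h₄ hy
  rw [Real.dist_eq, abs_lt]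
  constructor <;> nlinarith

theorem tendsto_psi_div_id : Tendsto (fun x ↦ psi x / x) atTop (𝓝 1) := by
  refine (tendsto_psi_exp_mul_exp_neg.comp tendsto_log_atTop).congr' ?_
  filter_upwards [eventually_gt_atTop 0] with x hx
  rw [Function.comp, exp_neg, exp_log hx, div_eq_mul_inv]

theorem tendsto_theta_div_id : Tendsto (fun x ↦ theta x / x) atTop (𝓝 1) := by
  have hsqrt : Tendsto (fun x : ℝ ↦ √x / x) atTop (𝓝 0) := by
    simp only [sqrt_div_self', one_div]
    exact tendsto_sqrt_atTop.inv_tendsto_atTop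
  have h : Tendsto (fun x ↦ (psi - theta) x / x) atTop (𝓝 0) :=
    (isBigO_psi_sub_theta_sqrt.mul (Asymptotics.isBigO_refl (fun x : ℝ ↦ x⁻¹) atTop)).trans_tendsto
      hsqrt
  have := tendsto_psi_div_id.sub h
  rw [sub_zero] at this
  exact this.congr fun x ↦ by rw [Pi.sub_apply]; ring

/-- The **Prime Number Theorem**. -/
theorem tendsto_primeCounting_mul_log_div_id :
    Tendsto (fun x : ℝ ↦ (Nat.primeCounting ⌊x⌋₊ : ℝ) * log x / x) atTop (𝓝 1) := by
  have hlim : Tendsto (fun x : ℝ ↦ (log x)⁻¹) atTop (𝓝 0) := tendsto_log_atTop.inv_tendsto_atTop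
  have h : Tendsto (fun x : ℝ ↦ ((Nat.primeCounting ⌊x⌋₊ : ℝ) - theta x / log x) * (log x / x))
      atTop (𝓝 0) := by
    refine (primeCounting_sub_theta_div_log_isBigO.mul
      (Asymptotics.isBigO_refl (fun x : ℝ ↦ log x / x) atTop)).trans_tendsto (hlim.congr' ?_)
    filter_upwards [eventually_gt_atTop 1] with x hx
    have := log_pos hx
    field_simp
  have := h.add tendsto_theta_div_id
  rw [zero_add] at this
  refine this.congr' ?_
  filter_upwards [eventually_gt_atTop 1] with x hx
  have := log_pos hx
  field_simp
  ring

theorem pi_alt :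
    ∃ c : ℝ → ℝ, c =o[atTop] (fun _ ↦ (1 : ℝ)) ∧
      ∀ x : ℝ, (Nat.primeCounting ⌊x⌋₊ : ℝ) = (1 + c x) * x / Real.log x := by
  refine ⟨fun x ↦ (Nat.primeCounting ⌊x⌋₊ : ℝ) * log x / x - 1, ?_, fun x ↦ ?_⟩
  · rw [Asymptotics.isLittleO_one_iff]
    simpa using tendsto_primeCounting_mul_log_div_id.sub_const 1
  · rcases lt_or_ge x 2 with hx | hx
    · have : Nat.primeCounting ⌊x⌋₊ = 0 :=
        Nat.primeCounting_eq_zero_iff.2 (Nat.le_of_lt_succ ((Nat.floor_lt' two_ne_zero).2 hx))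
      simp [this]
    · have := log_pos (by linarith : 1 < x)
      rw [add_sub_cancel]
      field_simp
end

section
/- The lower Lebesgue integral over (0,1)³ of ENNReal.ofReal(1/(1−(1−yz)x)) equals ENNReal.ofReal(2 · Σ_{n∈ℕ} 1/(n+1)³); equivalently, ∫∫∫_{(0,1)³} 1/(1−(1−yz)x) dμ = 2·ζ(3). In particular this function has finite integral on (0,1)³. -/
open MeasureTheory

/-- The fundamental theorem of calculus as a lower integral, for a nonnegative derivative. -/
theorem lintegral_Ioo_zero_one_of_hasDerivAt {f f' : ℝ → ℝ}
    (hcont : ContinuousOn f (Set.Icc 0 1))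
    (hderiv : ∀ x ∈ Set.Ioo (0 : ℝ) 1, HasDerivAt f (f' x) x)
    (hnonneg : ∀ x ∈ Set.Ioo (0 : ℝ) 1, 0 ≤ f' x) :
    ∫⁻ x in Set.Ioo (0 : ℝ) 1, ENNReal.ofReal (f' x) = ENNReal.ofReal (f 1 - f 0) := by
  have hint : IntegrableOn f' (Set.Ioc 0 1) :=
    intervalIntegral.integrableOn_deriv_of_nonneg hcont hderiv hnonneg
  rw [← ofReal_integral_eq_lintegral_ofReal (hint.mono_set Set.Ioo_subset_Ioc_self)
      ((ae_restrict_iff' measurableSet_Ioo).2 (.of_forall hnonneg)),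
    ← integral_Ioc_eq_integral_Ioo, ← intervalIntegral.integral_of_le zero_le_one,
    intervalIntegral.integral_eq_sub_of_hasDerivAt_of_le zero_le_one hcont hderiv
      ((intervalIntegrable_iff_integrableOn_Ioc_of_le zero_le_one).2 hint)]

theorem lintegral_Ioo_pow (n : ℕ) :
    ∫⁻ x in Set.Ioo (0 : ℝ) 1, ENNReal.ofReal (x ^ n) = ENNReal.ofReal (1 / ((n : ℝ) + 1)) := by
  have hn : (n : ℝ) + 1 ≠ 0 := by positivity
  rw [lintegral_Ioo_zero_one_of_hasDerivAt (f := fun x ↦ x ^ (n + 1) / ((n : ℝ) + 1))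
    (by fun_prop) _ (fun x hx ↦ pow_nonneg hx.1.le n)]
  · simp
  · intro x _
    refine ((hasDerivAt_pow (n + 1) x).div_const _).congr_deriv ?_
    push_cast
    field_simp

theorem lintegral_Ioo_pow_mul_neg_log (n : ℕ) :
    ∫⁻ x in Set.Ioo (0 : ℝ) 1, ENNReal.ofReal (x ^ n * -Real.log x) =
      ENNReal.ofReal (1 / ((n : ℝ) + 1) ^ 2) := by
  have hn : (n : ℝ) + 1 ≠ 0 := by positivity
  have hc : Continuous fun x : ℝ ↦ x * Real.log x := Real.continuous_mul_log
  rw [lintegral_Ioo_zero_one_of_hasDerivAt (f := fun x ↦ x ^ (n + 1) / ((n : ℝ) + 1) ^ 2 -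
      x ^ n * (x * Real.log x) / ((n : ℝ) + 1)) (by fun_prop)]
  · simp
  · intro x hx
    have hx0 : x ≠ 0 := hx.1.ne'
    have h := (((hasDerivAt_pow (n + 1) x).div_const (((n : ℝ) + 1) ^ 2)).sub
      (((hasDerivAt_pow (n + 1) x).mul (Real.hasDerivAt_log hx0)).div_const ((n : ℝ) + 1)))
    refine (h.congr_deriv ?_).congr_of_eventuallyEq (.of_forall fun y ↦ ?_)
    · push_cast
      field_simp
      ring
    · simp only [Pi.sub_apply, Pi.mul_apply]
      ring
  · intro x hx
    exact mul_nonneg (pow_nonneg hx.1.le n)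
      (neg_nonneg.2 (Real.log_nonpos hx.1.le hx.2.le))

theorem lintegral_Ioo_one_div_one_sub_mul {a : ℝ} (h0 : 0 < a) (h1 : a < 1) :
    ∫⁻ x in Set.Ioo (0 : ℝ) 1, ENNReal.ofReal (1 / (1 - (1 - a) * x)) =
      ENNReal.ofReal (-Real.log a / (1 - a)) := by
  have ha : 1 - a ≠ 0 := (sub_pos.2 h1).ne'
  have hpos : ∀ x ∈ Set.Icc (0 : ℝ) 1, 0 < 1 - (1 - a) * x := fun x hx ↦ by
    nlinarith [hx.1, hx.2]
  rw [lintegral_Ioo_zero_one_of_hasDerivAt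
    (f := fun x ↦ -Real.log (1 - (1 - a) * x) / (1 - a))]
  · simp
  · exact ((ContinuousOn.log (by fun_prop) fun x hx ↦ (hpos x hx).ne').neg).div_const _
  · intro x hx
    have hx' := (hpos x (Set.Ioo_subset_Icc_self hx)).ne'
    have h := (((((hasDerivAt_id x).const_mul (1 - a)).const_sub 1).log hx').neg).div_const (1 - a)
    refine h.congr_deriv ?_
    simp only [id]
    field_simp
  · intro x hx
    exact (one_div_pos.2 (hpos x (Set.Ioo_subset_Icc_self hx))).le

theorem ofReal_neg_log_mul_div_one_sub_eq_tsum {y z : ℝ} (hy : y ∈ Set.Ioo (0 : ℝ) 1)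
    (hz : z ∈ Set.Ioo (0 : ℝ) 1) :
    ENNReal.ofReal (-Real.log (y * z) / (1 - y * z)) =
      ∑' n : ℕ, (ENNReal.ofReal (y ^ n * -Real.log y) * ENNReal.ofReal (z ^ n) +
        ENNReal.ofReal (y ^ n) * ENNReal.ofReal (z ^ n * -Real.log z)) := by
  obtain ⟨hy0, hy1⟩ := hy
  obtain ⟨hz0, hz1⟩ := hz
  have hly : 0 ≤ -Real.log y := neg_nonneg.2 (Real.log_nonpos hy0.le hy1.le)
  have hlz : 0 ≤ -Real.log z := neg_nonneg.2 (Real.log_nonpos hz0.le hz1.le)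
  have hyz : y * z < 1 := mul_lt_one_of_nonneg_of_lt_one_left hy0.le hy1 hz1.le
  have hs := (hasSum_geometric_of_lt_one (mul_pos hy0 hz0).le hyz).mul_left (-Real.log (y * z))
  rw [div_eq_mul_inv, ← hs.tsum_eq, ENNReal.ofReal_tsum_of_nonneg _ hs.summable]
  · refine tsum_congr fun n ↦ ?_
    rw [← ENNReal.ofReal_mul (by positivity), ← ENNReal.ofReal_mul (by positivity),
      ← ENNReal.ofReal_add (by positivity) (by positivity), Real.log_mul hy0.ne' hz0.ne']
    congr 1
    ring
  · intro n
    rw [Real.log_mul hy0.ne' hz0.ne', neg_add]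
    positivity

theorem lintegral_Ioo_prod_neg_log_mul_div_one_sub :
    ∫⁻ p : ℝ × ℝ in Set.Ioo (0 : ℝ) 1 ×ˢ Set.Ioo (0 : ℝ) 1,
        ENNReal.ofReal (-Real.log (p.1 * p.2) / (1 - p.1 * p.2)) =
      ENNReal.ofReal (2 * ∑' n : ℕ, 1 / ((n : ℝ) + 1) ^ 3) := by
  have hsum : Summable fun n : ℕ ↦ 1 / ((n : ℝ) + 1) ^ 3 := by
    simpa using (summable_nat_add_iff 1).2 (Real.summable_one_div_nat_pow.2 (by norm_num : 1 < 3))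
  rw [setLIntegral_congr_fun (measurableSet_Ioo.prod measurableSet_Ioo)
      fun p hp ↦ ofReal_neg_log_mul_div_one_sub_eq_tsum hp.1 hp.2,
    lintegral_tsum fun n ↦ by fun_prop, ← tsum_mul_left,
    ENNReal.ofReal_tsum_of_nonneg (fun n ↦ by positivity) (hsum.mul_left 2)]
  refine tsum_congr fun n ↦ ?_
  rw [lintegral_add_left (by fun_prop), Measure.volume_eq_prod, ← Measure.prod_restrict,
    lintegral_prod_mul (f := fun y ↦ ENNReal.ofReal (y ^ n * -Real.log y))
      (g := fun z ↦ ENNReal.ofReal (z ^ n)) (by fun_prop) (by fun_prop),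
    lintegral_prod_mul (f := fun y ↦ ENNReal.ofReal (y ^ n))
      (g := fun z ↦ ENNReal.ofReal (z ^ n * -Real.log z)) (by fun_prop) (by fun_prop),
    lintegral_Ioo_pow, lintegral_Ioo_pow_mul_neg_log, ← ENNReal.ofReal_mul (by positivity),
    ← ENNReal.ofReal_mul (by positivity), ← ENNReal.ofReal_add (by positivity) (by positivity)]
  congr 1
  field_simp
  norm_num

theorem triple_eq_zeta3 :
    (∫⁻ x : ℝ × ℝ × ℝ in Set.Ioo (0 : ℝ) 1 ×ˢ Set.Ioo (0 : ℝ) 1 ×ˢ Set.Ioo (0 : ℝ) 1,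
        ENNReal.ofReal (1 / (1 - (1 - x.2.1 * x.2.2) * x.1))) =
      ENNReal.ofReal (2 * ∑' n : ℕ, 1 / ((n : ℝ) + 1) ^ 3) ∧
    HasFiniteIntegral (fun x : ℝ × ℝ × ℝ ↦ 1 / (1 - (1 - x.2.1 * x.2.2) * x.1))
      (volume.restrict (Set.Ioo (0 : ℝ) 1 ×ˢ Set.Ioo (0 : ℝ) 1 ×ˢ Set.Ioo (0 : ℝ) 1)) := by
  have hS : MeasurableSet (Set.Ioo (0 : ℝ) 1 ×ˢ Set.Ioo (0 : ℝ) 1) :=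
    measurableSet_Ioo.prod measurableSet_Ioo
  have hlt : ∀ p ∈ Set.Ioo (0 : ℝ) 1 ×ˢ Set.Ioo (0 : ℝ) 1, p.1 * p.2 < 1 := fun p hp ↦
    mul_lt_one_of_nonneg_of_lt_one_left hp.1.1.le hp.1.2 hp.2.2.le
  have key : (∫⁻ x : ℝ × ℝ × ℝ in Set.Ioo (0 : ℝ) 1 ×ˢ Set.Ioo (0 : ℝ) 1 ×ˢ Set.Ioo (0 : ℝ) 1,
        ENNReal.ofReal (1 / (1 - (1 - x.2.1 * x.2.2) * x.1))) =
      ENNReal.ofReal (2 * ∑' n : ℕ, 1 / ((n : ℝ) + 1) ^ 3) := by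
    rw [Measure.volume_eq_prod, ← Measure.prod_restrict, lintegral_prod_symm _ (by fun_prop),
      ← lintegral_Ioo_prod_neg_log_mul_div_one_sub]
    exact setLIntegral_congr_fun hS fun p hp ↦
      lintegral_Ioo_one_div_one_sub_mul (mul_pos hp.1.1 hp.2.1) (hlt p hp)
  refine ⟨key, ?_⟩
  rw [hasFiniteIntegral_iff_ofReal, key]
  · exact ENNReal.ofReal_lt_top
  · refine (ae_restrict_iff' (measurableSet_Ioo.prod hS)).2 (.of_forall fun x hx ↦ ?_)
    have h := mul_pos hx.2.1.1 hx.2.2.1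
    have hx1 := hx.1.2
    exact one_div_nonneg.2 (by nlinarith [hx.1.1, hlt x.2 hx.2])
end
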